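/- Let n ≥ 2 and let F : ℝⁿ → ℝ^{n+1} be an injective C^∞ map with ‖F(x)‖ = 1 for all x, which is conformal at every point of ℝⁿ (its derivative at each point is a nonzero scalar multiple of a linear isometry). Then for every open set Ω ⊆ ℝⁿ, ∫_Ω ‖DF(x)‖_{HS}ⁿ dx ≤ n^{n/2} · H^n({y ∈ ℝ^{n+1} : ‖y‖ = 1}), where ‖DF(x)‖_{HS}² = Σ_{j=1}^{n} ‖DF(x)(e_j)‖² is the squared Hilbert–Schmidt norm of the derivative of F at x (e_j the standard basis of ℝⁿ) and H^n denotes n-dimensional Hausdorff measure on ℝ^{n+1}. -/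

import Mathlib

open MeasureTheory

open scoped ENNReal Topology

/-- A measure inequality that holds near every point holds globally. -/
theorem measure_le_of_forall_exists_nhds {X : Type*} [TopologicalSpace X]
    [SecondCountableTopology X] [MeasurableSpace X] [OpensMeasurableSpace X] {μ ν : Measure X}
    (h : ∀ x, ∃ U ∈ 𝓝 x, ∀ s ⊆ U, MeasurableSet s → ν s ≤ μ s) : ν ≤ μ := by
  choose U hU hle using h
  refine Measure.le_iff.2 fun s hs => ?_
  obtain ⟨t, ht, hcov⟩ := TopologicalSpace.countable_cover_nhds
    fun x => interior_mem_nhds.2 (hU x)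
  rcases isEmpty_or_nonempty X with hX | ⟨⟨x₀⟩⟩
  · simp [Set.eq_empty_of_isEmpty s]
  have htne : t.Nonempty := by
    have : x₀ ∈ ⋃ x ∈ t, interior (U x) := hcov ▸ Set.mem_univ x₀
    obtain ⟨x, hx, -⟩ := Set.mem_iUnion₂.1 this
    exact ⟨x, hx⟩
  obtain ⟨f, rfl⟩ := ht.exists_eq_range htne
  rw [Set.biUnion_range] at hcov
  have hmeas : ∀ k, MeasurableSet (disjointed (fun k => interior (U (f k))) k) :=
    fun k => MeasurableSet.disjointed (fun _ => isOpen_interior.measurableSet) k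
  have hdecomp : s = ⋃ k, s ∩ disjointed (fun k => interior (U (f k))) k := by
    rw [← Set.inter_iUnion, iUnion_disjointed, hcov, Set.inter_univ]
  have hdisj : Pairwise (Function.onFun Disjoint
      fun k => s ∩ disjointed (fun k => interior (U (f k))) k) :=
    fun i j hij => (disjoint_disjointed _ hij).mono Set.inter_subset_right Set.inter_subset_right
  rw [hdecomp, measure_iUnion hdisj fun k => hs.inter (hmeas k),
    measure_iUnion hdisj fun k => hs.inter (hmeas k)]
  refine ENNReal.tsum_le_tsum fun k => hle (f k) _ ?_ (hs.inter (hmeas k))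
  exact Set.inter_subset_right.trans ((disjointed_subset _ k).trans interior_subset)

/-- Lebesgue measure on Euclidean space is at most the (unnormalized) Hausdorff measure. -/
theorem volume_le_hausdorffMeasure_euclideanSpace (n : ℕ) (s : Set (EuclideanSpace ℝ (Fin n))) :
    volume s ≤ μH[(n : ℝ)] s := by
  have hlip : LipschitzWith 1 (WithLp.ofLp : EuclideanSpace ℝ (Fin n) → Fin n → ℝ) :=
    PiLp.lipschitzWith_ofLp 2 _
  have hvol : (μH[(n : ℝ)] : Measure (Fin n → ℝ)) = volume := by
    simpa using hausdorffMeasure_pi_real (ι := Fin n)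
  have h := hlip.hausdorffMeasure_image_le (Nat.cast_nonneg n) s
  rw [hvol] at h
  have hpre : volume (WithLp.ofLp '' s) = volume s := by
    rw [← (PiLp.volume_preserving_ofLp (Fin n)).measure_preimage_emb
      (MeasurableEquiv.toLp 2 (Fin n → ℝ)).symm.measurableEmbedding,
      Set.preimage_image_eq _ (WithLp.ofLp_injective 2)]
  simpa [hpre] using h

/-- A `C¹` image of a compact subset of `ℝⁿ` has finite `n`-dimensional Hausdorff measure. -/
theorem hausdorffMeasure_image_lt_top_of_isCompact {n : ℕ} {G : Type*} [NormedAddCommGroup G]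
    [NormedSpace ℝ G] [MeasurableSpace G] [BorelSpace G] {g : (Fin n → ℝ) → G}
    (hg : ContDiff ℝ 1 g) {K : Set (Fin n → ℝ)} (hK : IsCompact K) :
    μH[(n : ℝ)] (g '' K) < ∞ := by
  obtain ⟨C, hC⟩ := (hg.locallyLipschitz.locallyLipschitzOn
    (s := K)).exists_lipschitzOnWith_of_compact hK
  have hvol : (μH[(n : ℝ)] : Measure (Fin n → ℝ)) = volume := by
    simpa using hausdorffMeasure_pi_real (ι := Fin n)
  refine (hC.hausdorffMeasure_image_le (Nat.cast_nonneg n)).trans_lt ?_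
  rw [hvol]
  exact ENNReal.mul_lt_top (ENNReal.rpow_lt_top_of_nonneg (Nat.cast_nonneg n) ENNReal.coe_ne_top)
    hK.measure_lt_top

/-- The unit sphere of `ℝ^{n+1}` has finite `n`-dimensional Hausdorff measure. -/
theorem hausdorffMeasure_unitSphere_lt_top (n : ℕ) :
    μH[(n : ℝ)] {y : EuclideanSpace ℝ (Fin (n + 1)) | ‖y‖ = 1} < ∞ := by
  let w : Fin (n + 1) → ℝ → (Fin n → ℝ) → EuclideanSpace ℝ (Fin (n + 1)) :=
    fun i ε u => WithLp.toLp 2 (i.insertNth ε u : Fin (n + 1) → ℝ)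
  have hw : ∀ i ε, ContDiff ℝ 1 (w i ε) := by
    intro i ε
    rw [contDiff_euclidean]
    intro j
    refine Fin.succAboveCases i ?_ (fun k => ?_) j
    · simpa [w] using contDiff_const
    · simpa [w] using contDiff_apply ℝ ℝ k
  have hw0 : ∀ i ε u, ε ≠ 0 → w i ε u ≠ 0 := by
    intro i ε u hε h
    apply hε
    simpa [w] using congrArg (fun y : EuclideanSpace ℝ (Fin (n + 1)) => y i) h
  have hg : ∀ i ε, ε ≠ 0 → ContDiff ℝ 1 fun u => ‖w i ε u‖⁻¹ • w i ε u := fun i ε hε =>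
    (((hw i ε).norm ℝ fun u => hw0 i ε u hε).inv fun u => norm_ne_zero_iff.2 (hw0 i ε u hε)).smul
      (hw i ε)
  have hsub : {y : EuclideanSpace ℝ (Fin (n + 1)) | ‖y‖ = 1} ⊆ ⋃ i,
      ((fun u => ‖w i 1 u‖⁻¹ • w i 1 u) '' Set.Icc (-1) 1 ∪
        (fun u => ‖w i (-1) u‖⁻¹ • w i (-1) u) '' Set.Icc (-1) 1) := by
    intro y hy
    obtain ⟨i, -, hi⟩ := Finset.exists_max_image Finset.univ (fun j => |y j|) ⟨0, Finset.mem_univ _⟩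
    have hm : 0 < |y i| := by
      by_contra hm
      have : y = 0 := by
        ext j
        have := hi j (Finset.mem_univ j)
        exact abs_nonpos_iff.1 (this.trans (not_lt.1 hm))
      simp [this] at hy
    let u : Fin n → ℝ := fun j => y (i.succAbove j) / |y i|
    have hu : u ∈ Set.Icc (-1 : Fin n → ℝ) 1 := by
      have hj : ∀ j, |u j| ≤ 1 := fun j => by
        change |(y (i.succAbove j) / |y i|)| ≤ 1
        rw [abs_div, abs_abs, div_le_one hm]
        exact hi _ (Finset.mem_univ _)
      exact ⟨fun j => (abs_le.1 (hj j)).1, fun j => (abs_le.1 (hj j)).2⟩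
    have key : ∀ ε, y i / |y i| = ε → ‖w i ε u‖⁻¹ • w i ε u = y := by
      intro ε hε
      have hwy : w i ε u = |y i|⁻¹ • y := by
        ext j
        refine Fin.succAboveCases i ?_ (fun k => ?_) j
        · simp [w, ← hε, div_eq_inv_mul]
        · simp [w, u, div_eq_inv_mul]
      rw [hwy, norm_smul, show ‖y‖ = 1 from hy, mul_one, norm_inv, Real.norm_eq_abs, abs_abs,
        inv_inv, smul_inv_smul₀ hm.ne']
    refine Set.mem_iUnion.2 ⟨i, ?_⟩
    rcases lt_or_gt_of_ne (abs_pos.1 hm) with h | h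
    · exact Or.inr ⟨_, hu, key _ (by rw [abs_of_neg h, div_neg, div_self h.ne])⟩
    · exact Or.inl ⟨_, hu, key _ (by rw [abs_of_pos h, div_self h.ne'])⟩
  refine (measure_mono hsub).trans_lt ((measure_iUnion_fintype_le _ _).trans_lt ?_)
  refine ENNReal.sum_lt_top.2 fun i _ => (measure_union_le _ _).trans_lt (ENNReal.add_lt_top.2 ?_)
  exact ⟨hausdorffMeasure_image_lt_top_of_isCompact (hg i 1 one_ne_zero) isCompact_Icc,
    hausdorffMeasure_image_lt_top_of_isCompact (hg i (-1) (by norm_num)) isCompact_Icc⟩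

section Conformal

variable {E G : Type*} [NormedAddCommGroup E] [NormedSpace ℝ E] [NormedAddCommGroup G]
  [NormedSpace ℝ G]

theorem IsConformalMap.norm_apply [Nontrivial E] {f : E →L[ℝ] G} (hf : IsConformalMap f) (v : E) :
    ‖f v‖ = ‖f‖ * ‖v‖ := by
  obtain ⟨c, hc, li, rfl⟩ := hf
  simp [norm_smul, LinearIsometry.norm_toContinuousLinearMap]

theorem IsConformalMap.norm_pos [Nontrivial E] {f : E →L[ℝ] G} (hf : IsConformalMap f) :
    0 < ‖f‖ :=
  norm_pos_iff.2 hf.ne_zero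

/-- Near each point, a `C¹` conformal map `f` expands distances by nearly `‖fderiv ℝ f x‖`. -/
theorem ContDiff.exists_nhds_norm_fderiv_lt_and_mul_norm_sub_le [Nontrivial E] {f : E → G}
    (hf : ContDiff ℝ 1 f) {x : E} (hx : IsConformalMap (fderiv ℝ f x)) {k : ℝ} (hk : 1 < k) :
    ∃ U ∈ 𝓝 x, (∀ z ∈ U, ‖fderiv ℝ f z‖ < k * ‖fderiv ℝ f x‖) ∧
      ∀ y ∈ U, ∀ z ∈ U, ‖fderiv ℝ f x‖ / k * ‖y - z‖ ≤ ‖f y - f z‖ := by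
  set L := ‖fderiv ℝ f x‖ with hL
  have hLpos : 0 < L := hx.norm_pos
  have hc : 0 < L * (1 - k⁻¹) := mul_pos hLpos (sub_pos.2 (inv_lt_one_of_one_lt₀ hk))
  obtain ⟨U, hU, happ⟩ := (hf.contDiffAt.hasStrictFDerivAt one_ne_zero).approximates_deriv_on_nhds
    (c := ⟨L * (1 - k⁻¹), hc.le⟩) (Or.inr hc)
  have hV : {z | ‖fderiv ℝ f z‖ < k * L} ∈ 𝓝 x :=
    ((hf.continuous_fderiv one_ne_zero).norm.continuousAt).eventually_lt_const (by
      change L < k * L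
      nlinarith)
  refine ⟨U ∩ {z | ‖fderiv ℝ f z‖ < k * L}, Filter.inter_mem hU hV, fun z hz => hz.2,
    fun y hy z hz => ?_⟩
  have h1 : ‖f y - f z - fderiv ℝ f x (y - z)‖ ≤ L * (1 - k⁻¹) * ‖y - z‖ := happ y hy.1 z hz.1
  have h2 := norm_sub_norm_le (fderiv ℝ f x (y - z)) (f y - f z)
  rw [norm_sub_rev (fderiv ℝ f x (y - z)) (f y - f z), hx.norm_apply, ← hL] at h2
  have h3 : L / k * ‖y - z‖ = L * ‖y - z‖ - L * (1 - k⁻¹) * ‖y - z‖ := by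
    rw [div_eq_mul_inv]; ring
  linarith

end Conformal

/-- The integral of the Jacobian of an injective `C¹` conformal map is at most the
(unnormalized) Hausdorff measure of the image. -/
theorem lintegral_norm_fderiv_pow_le_hausdorffMeasure_image {n : ℕ} [NeZero n] {G : Type*}
    [NormedAddCommGroup G] [NormedSpace ℝ G] [MeasurableSpace G] [BorelSpace G]
    {f : EuclideanSpace ℝ (Fin n) → G} (hinj : Function.Injective f) (hf : ContDiff ℝ 1 f)
    (hconf : ∀ x, IsConformalMap (fderiv ℝ f x)) {s : Set (EuclideanSpace ℝ (Fin n))}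
    (hs : MeasurableSet s) :
    ∫⁻ x in s, ENNReal.ofReal (‖fderiv ℝ f x‖ ^ n) ≤ μH[(n : ℝ)] (f '' s) := by
  have hemb : MeasurableEmbedding f := hf.continuous.measurableEmbedding hinj
  have key : ∀ k : ℝ, 1 < k →
      ∫⁻ x in s, ENNReal.ofReal (‖fderiv ℝ f x‖ ^ n) ≤
        ENNReal.ofReal ((k * k) ^ n) * μH[(n : ℝ)] (f '' s) := by
    intro k hk
    have hk0 : 0 < k := zero_lt_one.trans hk
    have hle : volume.withDensity (fun x => ENNReal.ofReal (‖fderiv ℝ f x‖ ^ n)) ≤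
        ENNReal.ofReal ((k * k) ^ n) • Measure.comap f μH[(n : ℝ)] := by
      refine measure_le_of_forall_exists_nhds fun x => ?_
      obtain ⟨U, hU, hlt, hexp⟩ :=
        hf.exists_nhds_norm_fderiv_lt_and_mul_norm_sub_le (hconf x) hk
      have hL := (hconf x).norm_pos
      set L := ‖fderiv ℝ f x‖
      refine ⟨U, hU, fun t ht htm => ?_⟩
      have hlip : LipschitzOnWith (k / L).toNNReal (Function.invFun f) (f '' t) := by
        refine LipschitzOnWith.of_dist_le_mul ?_
        rintro _ ⟨y, hy, rfl⟩ _ ⟨z, hz, rfl⟩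
        rw [Function.leftInverse_invFun hinj y, Function.leftInverse_invFun hinj z,
          Real.coe_toNNReal _ (div_pos hk0 hL).le, dist_eq_norm, dist_eq_norm]
        have h := hexp y (ht hy) z (ht hz)
        calc ‖y - z‖ = k / L * (L / k * ‖y - z‖) := by field_simp
          _ ≤ k / L * ‖f y - f z‖ := by gcongr
      have himg := hlip.hausdorffMeasure_image_le (Nat.cast_nonneg n)
      rw [(Function.leftInverse_invFun hinj).image_image, ENNReal.rpow_natCast] at himg
      rw [withDensity_apply _ htm, Measure.smul_apply, smul_eq_mul, hemb.comap_apply]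
      calc ∫⁻ z in t, ENNReal.ofReal (‖fderiv ℝ f z‖ ^ n)
          ≤ ∫⁻ _ in t, ENNReal.ofReal ((k * L) ^ n) := by
            refine setLIntegral_mono' htm fun z hz => ENNReal.ofReal_le_ofReal ?_
            exact pow_le_pow_left₀ (norm_nonneg _) (hlt z (ht hz)).le n
        _ = ENNReal.ofReal ((k * L) ^ n) * volume t := setLIntegral_const _ _
        _ ≤ ENNReal.ofReal ((k * L) ^ n) *
            (ENNReal.ofReal (k / L) ^ n * μH[(n : ℝ)] (f '' t)) := by
            gcongr
            exact (volume_le_hausdorffMeasure_euclideanSpace n t).trans himg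
        _ = ENNReal.ofReal ((k * k) ^ n) * μH[(n : ℝ)] (f '' t) := by
            rw [← mul_assoc, ← ENNReal.ofReal_pow (by positivity),
              ← ENNReal.ofReal_mul (by positivity), ← mul_pow]
            congr 3
            field_simp
    have := hle s
    rwa [withDensity_apply _ hs, Measure.smul_apply, smul_eq_mul, hemb.comap_apply] at this
  have hlim : Filter.Tendsto (fun k : ℝ => ENNReal.ofReal ((k * k) ^ n) * μH[(n : ℝ)] (f '' s))
      (𝓝[>] 1) (𝓝 (1 * μH[(n : ℝ)] (f '' s))) := by
    refine ENNReal.Tendsto.mul_const ?_ (Or.inl one_ne_zero)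
    have : Continuous fun k : ℝ => ENNReal.ofReal ((k * k) ^ n) :=
      ENNReal.continuous_ofReal.comp (by fun_prop)
    simpa using (this.tendsto 1).mono_left nhdsWithin_le_nhds
  rw [one_mul] at hlim
  exact ge_of_tendsto hlim (eventually_mem_nhdsWithin.mono key)

/-- Conformal energy bound: the `n`-energy of an injective conformal map into the unit
sphere `Sⁿ ⊆ ℝ^{n+1}` is at most `n^{n/2}` times the `n`-dimensional Hausdorff measure of
the sphere. Here `‖DF(x)‖_{HS}² = Σ_j ‖DF(x)(e_j)‖²` and we integrate
`‖DF(x)‖_{HS}ⁿ = (‖DF(x)‖_{HS}²)^{n/2}`. -/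
theorem stmt3 {n : ℕ} (hn : 2 ≤ n)
    (F : EuclideanSpace ℝ (Fin n) → EuclideanSpace ℝ (Fin (n + 1)))
    (hinj : Function.Injective F) (hsm : ContDiff ℝ (⊤ : ℕ∞) F)
    (hsph : ∀ x, ‖F x‖ = 1)
    (hconf : ∀ x, IsConformalMap (fderiv ℝ F x)) :
    ∀ Ω : Set (EuclideanSpace ℝ (Fin n)), IsOpen Ω →
      (∫ x in Ω,
          (∑ j : Fin n, ‖fderiv ℝ F x (EuclideanSpace.single j (1 : ℝ))‖ ^ 2) ^ ((n : ℝ) / 2))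
        ≤ (n : ℝ) ^ ((n : ℝ) / 2) *
          (μH[(n : ℝ)] {y : EuclideanSpace ℝ (Fin (n + 1)) | ‖y‖ = 1}).toReal := by
  intro Ω hΩ
  have : NeZero n := ⟨by omega⟩
  have hf : ContDiff ℝ 1 F := hsm.of_le (by exact_mod_cast le_top)
  have hHS : ∀ x, (∑ j : Fin n, ‖fderiv ℝ F x (EuclideanSpace.single j (1 : ℝ))‖ ^ 2) ^ ((n : ℝ) / 2)
      = (n : ℝ) ^ ((n : ℝ) / 2) * ‖fderiv ℝ F x‖ ^ n := by
    intro x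
    simp only [(hconf x).norm_apply, PiLp.norm_single, norm_one, mul_one,
      Finset.sum_const, Finset.card_univ, Fintype.card_fin, nsmul_eq_mul]
    rw [Real.mul_rpow (Nat.cast_nonneg n) (by positivity), ← Real.rpow_natCast _ 2,
      ← Real.rpow_mul (norm_nonneg _), ← Real.rpow_natCast _ n]
    congr 2
    push_cast
    ring
  simp only [hHS]
  rw [integral_const_mul]
  refine mul_le_mul_of_nonneg_left ?_ (by positivity)
  have hcont : Continuous fun x => ‖fderiv ℝ F x‖ ^ n :=
    (hf.continuous_fderiv one_ne_zero).norm.pow n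
  rw [integral_eq_lintegral_of_nonneg_ae (Filter.Eventually.of_forall fun x => by positivity)
    hcont.aestronglyMeasurable]
  refine ENNReal.toReal_mono (hausdorffMeasure_unitSphere_lt_top n).ne ?_
  refine (lintegral_norm_fderiv_pow_le_hausdorffMeasure_image hinj hf hconf
    hΩ.measurableSet).trans (measure_mono ?_)
  rintro _ ⟨x, -, rfl⟩
  exact hsph x
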